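/- arXiv:2401.17854 — 4 statements merged into one kernel-verified Lean document; each statement's English description precedes it below -/
import Mathlib

section
/- Let x : ℝ → ℝ³ be a C^∞ curve parametrized by arclength and fix s₀ with κ > 0 on a neighborhood of s₀. Set x₁ = x(s₀−ε), x₂ = x(s₀), x₃ = x(s₀+ε). Then, as ε → 0 (ε ≠ 0), ⟨x₁−x₂, x₂−x₃⟩/(‖x₁−x₂‖·‖x₂−x₃‖) = 1 − (κ²/2)·ε² + (κ⁴/24 + κ²τ²/12 − κ·κ''/12)·ε⁴ + O(ε⁶), where κ, τ and κ'' (the second derivative of s ↦ κ(s)) are evaluated at s₀. -/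
open scoped RealInnerProductSpace Topology
open Asymptotics

noncomputable section

abbrev E3 := EuclideanSpace ℝ (Fin 3)

/-- Cross product on `ℝ³`. -/
def cross3 (u v : E3) : E3 :=
  (WithLp.equiv 2 (Fin 3 → ℝ)).symm
    ![u 1 * v 2 - u 2 * v 1, u 2 * v 0 - u 0 * v 2, u 0 * v 1 - u 1 * v 0]

/-- Curvature of an arclength-parametrized curve. -/
def curv (x : ℝ → E3) (s : ℝ) : ℝ := ‖iteratedDeriv 2 x s‖

/-- Torsion of an arclength-parametrized curve (where `curv x s > 0`). -/
def tors (x : ℝ → E3) (s : ℝ) : ℝ :=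
  ⟪cross3 (deriv x s) (iteratedDeriv 2 x s), iteratedDeriv 3 x s⟫ / curv x s ^ 2

section ScalarExpansion

variable {l : Filter ℝ}

theorem isBigO_pow_mul_of_bounded (n : ℕ) {g : ℝ → ℝ} (hg : g =O[l] fun _ => (1 : ℝ)) :
    (fun ε => ε ^ n * g ε) =O[l] fun ε => ε ^ n := by
  simpa using (isBigO_refl (fun ε : ℝ => ε ^ n) l).mul hg

theorem isBigO_one_inner {E : Type*} [NormedAddCommGroup E] [InnerProductSpace ℝ E]
    {f g : ℝ → E} (hf : f =O[l] fun _ => (1 : ℝ)) (hg : g =O[l] fun _ => (1 : ℝ)) :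
    (fun ε => ⟪f ε, g ε⟫) =O[l] fun _ => (1 : ℝ) := by
  have h : (fun ε => ⟪f ε, g ε⟫) =O[l] fun ε => ‖f ε‖ * ‖g ε‖ :=
    isBigO_of_le _ fun ε => by
      simpa using norm_inner_le_norm (𝕜 := ℝ) (f ε) (g ε)
  simpa using h.trans (hf.norm_left.mul hg.norm_left)

theorem isBigO_one_smul {E : Type*} [NormedAddCommGroup E] [NormedSpace ℝ E]
    {f : ℝ → ℝ} {g : ℝ → E} (hf : f =O[l] fun _ => (1 : ℝ)) (hg : g =O[l] fun _ => (1 : ℝ)) :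
    (fun ε => f ε • g ε) =O[l] fun _ => (1 : ℝ) := by
  simpa using hf.smul hg

theorem isBigO_pow_one (n : ℕ) (hl : l ≤ 𝓝 0) :
    (fun ε : ℝ => ε ^ n) =O[l] fun _ => (1 : ℝ) :=
  (((continuous_pow n).tendsto (0 : ℝ)).mono_left hl).isBigO_one ℝ

/-- Expansion of `(S - 2B) / √(S² - 4C²)` from expansions of `S`, `B` and a bound on `C`. -/
theorem isBigO_ratio_expansion (hl : l ≤ 𝓝 0) {S B C N : ℝ → ℝ} {k m : ℝ}
    (hS : (fun ε => S ε - (1 - k / 12 * ε ^ 2)) =O[l] fun ε => ε ^ 4)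
    (hB : (fun ε => B ε - (k / 4 * ε ^ 2 + m / 24 * ε ^ 4)) =O[l] fun ε => ε ^ 6)
    (hC : C =O[l] fun ε => ε ^ 3) (hN : ∀ ε, 0 ≤ N ε)
    (hNS : ∀ ε, N ε ^ 2 = S ε ^ 2 - 4 * C ε ^ 2) :
    (fun ε => (S ε - 2 * B ε) / N ε -
      (1 - k / 2 * ε ^ 2 - (m / 12 + k ^ 2 / 24) * ε ^ 4)) =O[l] fun ε => ε ^ 6 := by
  have tendsto_poly {f : ℝ → ℝ} (hf : Continuous f) : Filter.Tendsto f l (𝓝 (f 0)) :=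
    (hf.tendsto 0).mono_left hl
  have hS1 : Filter.Tendsto S l (𝓝 1) := by
    have h1 := hS.trans_tendsto (by simpa only [zero_pow, ne_eq, OfNat.ofNat_ne_zero,
      not_false_eq_true] using tendsto_poly (continuous_pow 4))
    have h2 := tendsto_poly (f := fun ε => 1 - k / 12 * ε ^ 2) (by fun_prop)
    simpa using h1.add h2
  have hC2 : (fun ε => C ε ^ 2) =O[l] fun ε => ε ^ 6 := by
    simpa [← pow_mul] using hC.pow 2
  have hSN : (fun ε => S ε - N ε) =O[l] fun ε => ε ^ 6 := by
    refine IsBigO.trans (IsBigO.of_bound 8 ?_) hC2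
    filter_upwards [hS1.eventually (lt_mem_nhds (show (1 / 2 : ℝ) < 1 by norm_num))] with ε hε
    rw [Real.norm_eq_abs, Real.norm_eq_abs, abs_of_nonneg (sq_nonneg (C ε))]
    have hNε := hN ε
    have hle : N ε ≤ S ε := by
      nlinarith [hNS ε, sq_nonneg (C ε)]
    rw [abs_of_nonneg (by linarith)]
    nlinarith [hNS ε]
  have hN1 : Filter.Tendsto N l (𝓝 1) := by
    have h1 := hSN.trans_tendsto (by simpa only [zero_pow, ne_eq, OfNat.ofNat_ne_zero,
      not_false_eq_true] using tendsto_poly (continuous_pow 6))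
    simpa using hS1.sub h1
  have hinv : (fun ε => (N ε)⁻¹) =O[l] fun _ => (1 : ℝ) :=
    (hN1.inv₀ one_ne_zero).isBigO_one ℝ
  set t : ℝ → ℝ := fun ε => 1 - k / 2 * ε ^ 2 - (m / 12 + k ^ 2 / 24) * ε ^ 4 with ht
  have ht1 : t =O[l] fun _ => (1 : ℝ) :=
    (tendsto_poly (f := t) (by fun_prop)).isBigO_one ℝ
  have hw : (fun ε : ℝ => k / 2 + (m / 12 + k ^ 2 / 24) * ε ^ 2) =O[l] fun _ => (1 : ℝ) :=
    (tendsto_poly (f := fun ε : ℝ => k / 2 + (m / 12 + k ^ 2 / 24) * ε ^ 2)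
      (by fun_prop)).isBigO_one ℝ
  have hnum : (fun ε => S ε - 2 * B ε - t ε * N ε) =O[l] fun ε => ε ^ 6 := by
    have h1 : (fun ε => t ε * (S ε - N ε)) =O[l] fun ε => ε ^ 6 := by
      simpa using ht1.mul hSN
    have h2 : (fun ε => (S ε - (1 - k / 12 * ε ^ 2)) *
        (ε ^ 2 * (k / 2 + (m / 12 + k ^ 2 / 24) * ε ^ 2))) =O[l] fun ε => ε ^ 6 := by
      simpa [← pow_add] using hS.mul (isBigO_pow_mul_of_bounded 2 hw)
    have h3 : (fun ε : ℝ => k * (m / 12 + k ^ 2 / 24) / 12 * ε ^ 6) =O[l] fun ε => ε ^ 6 :=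
      (isBigO_refl _ _).const_mul_left _
    refine (((hB.const_mul_left (-2)).add h1).add (h2.sub h3)).congr_left fun ε => ?_
    simp only [ht]
    ring
  have hmain : (fun ε => (S ε - 2 * B ε - t ε * N ε) * (N ε)⁻¹) =O[l] fun ε => ε ^ 6 := by
    simpa using hnum.mul hinv
  refine hmain.congr' ?_ .rfl
  filter_upwards [hN1.eventually_ne one_ne_zero] with ε hε
  rw [sub_mul, mul_inv_cancel_right₀ hε, div_eq_mul_inv]

end ScalarExpansion

section VectorExpansion

variable {E : Type*} [NormedAddCommGroup E] [InnerProductSpace ℝ E]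

/-- Expansion of the cosine of the angle between consecutive chords of a curve `y` through the
origin, from a fifth order Taylor expansion of `y`. -/
theorem isBigO_cos_chords {y r : ℝ → E} {a b c d e : E}
    (hr : r =O[𝓝 0] fun _ => (1 : ℝ))
    (hy : ∀ ε, y ε = ε • a + (ε ^ 2 / 2) • b + (ε ^ 3 / 6) • c + (ε ^ 4 / 24) • d +
      (ε ^ 5 / 120) • e + ε ^ 6 • r ε)
    (haa : ⟪a, a⟫ = 1) (hab : ⟪a, b⟫ = 0) (hac : ⟪a, c⟫ = -⟪b, b⟫) :
    (fun ε => ⟪y (-ε), -y ε⟫ / (‖y (-ε)‖ * ‖-y ε‖) -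
      (1 - ⟪b, b⟫ / 2 * ε ^ 2 - (⟪b, d⟫ / 12 + ⟪b, b⟫ ^ 2 / 24) * ε ^ 4))
      =O[𝓝[≠] 0] fun ε => ε ^ 6 := by
  have hl : 𝓝[≠] (0 : ℝ) ≤ 𝓝 0 := nhdsWithin_le_nhds
  have hr₁ : r =O[𝓝[≠] 0] fun _ => (1 : ℝ) := hr.mono hl
  have hr₂ : (fun ε => r (-ε)) =O[𝓝[≠] 0] fun _ => (1 : ℝ) := by
    have : Filter.Tendsto (fun ε : ℝ => -ε) (𝓝[≠] 0) (𝓝 0) := by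
      simpa using (continuous_neg.tendsto (0 : ℝ)).mono_left hl
    exact hr.comp_tendsto this
  have hconst (v : E) : (fun _ : ℝ => v) =O[𝓝[≠] 0] fun _ => (1 : ℝ) :=
    isBigO_const_const v one_ne_zero _
  have hε (n : ℕ) : (fun ε : ℝ => ε ^ n) =O[𝓝[≠] 0] fun _ => (1 : ℝ) := isBigO_pow_one n hl
  obtain ⟨p, hp⟩ : ∃ p : ℝ → E, p = fun ε =>
    (1 / 120 : ℝ) • e + ε ^ 1 • ((1 / 2 : ℝ) • (r ε - r (-ε))) := ⟨_, rfl⟩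
  obtain ⟨q, hq⟩ : ∃ q : ℝ → E, q = fun ε => (1 / 2 : ℝ) • (r ε + r (-ε)) := ⟨_, rfl⟩
  have hpO : p =O[𝓝[≠] 0] fun _ => (1 : ℝ) := by
    rw [hp]
    exact (hconst _).add (isBigO_one_smul (hε 1) ((hr₁.sub hr₂).const_smul_left _))
  have hqO : q =O[𝓝[≠] 0] fun _ => (1 : ℝ) := by
    rw [hq]
    exact (hr₁.add hr₂).const_smul_left _
  obtain ⟨c', hc'⟩ : ∃ c' : ℝ → E, c' = fun ε => (1 / 6 : ℝ) • c + ε ^ 2 • p ε := ⟨_, rfl⟩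
  obtain ⟨d', hd'⟩ : ∃ d' : ℝ → E, d' = fun ε => (1 / 24 : ℝ) • d + ε ^ 2 • q ε := ⟨_, rfl⟩
  have hcO : c' =O[𝓝[≠] 0] fun _ => (1 : ℝ) := by
    rw [hc']
    exact (hconst _).add (isBigO_one_smul (hε 2) hpO)
  have hdO : d' =O[𝓝[≠] 0] fun _ => (1 : ℝ) := by
    rw [hd']
    exact (hconst _).add (isBigO_one_smul (hε 2) hqO)
  -- `y ε = ε • (O ε + V ε)` and `y (-ε) = ε • (V ε - O ε)`, with `O` and `V` the even and odd
  -- parts of `y ε / ε`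
  obtain ⟨O, hO⟩ : ∃ O : ℝ → E, O = fun ε => a + ε ^ 2 • c' ε := ⟨_, rfl⟩
  obtain ⟨V, hV⟩ : ∃ V : ℝ → E, V = fun ε => ε • ((1 / 2 : ℝ) • b + ε ^ 2 • d' ε) := ⟨_, rfl⟩
  have hy₁ (ε : ℝ) : y ε = ε • (O ε + V ε) := by
    rw [hy, hO, hV, hc', hd', hp, hq]
    module
  have hy₂ (ε : ℝ) : y (-ε) = ε • (V ε - O ε) := by
    rw [hy, hO, hV, hc', hd', hp, hq]
    module
  have hOO (ε : ℝ) : ⟪O ε, O ε⟫ = 1 - ⟪b, b⟫ / 3 * ε ^ 2 +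
      ε ^ 4 * (2 * ⟪a, p ε⟫ + ⟪c' ε, c' ε⟫) := by
    have h : ⟪a, c' ε⟫ = -⟪b, b⟫ / 6 + ε ^ 2 * ⟪a, p ε⟫ := by
      rw [hc']
      simp only [inner_add_right, inner_smul_right, hac]
      ring
    rw [hO]
    simp only [inner_add_left, inner_add_right, inner_smul_left, inner_smul_right,
      real_inner_comm a (c' ε), haa, h, conj_trivial]
    ring
  have hVV (ε : ℝ) : ⟪V ε, V ε⟫ = ⟪b, b⟫ / 4 * ε ^ 2 + ⟪b, d⟫ / 24 * ε ^ 4 +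
      ε ^ 6 * (⟪b, q ε⟫ + ⟪d' ε, d' ε⟫) := by
    have h : ⟪b, d' ε⟫ = ⟪b, d⟫ / 24 + ε ^ 2 * ⟪b, q ε⟫ := by
      rw [hd']
      simp only [inner_add_right, inner_smul_right]
      ring
    rw [hV]
    simp only [inner_add_left, inner_add_right, inner_smul_left, inner_smul_right,
      real_inner_comm b (d' ε), h, conj_trivial]
    ring
  have hOV (ε : ℝ) : ⟪O ε, V ε⟫ =
      ε ^ 3 * (⟪a, d' ε⟫ + (1 / 2) * ⟪c' ε, b⟫ + ε ^ 2 * ⟪c' ε, d' ε⟫) := by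
    rw [hO, hV]
    simp only [inner_add_left, inner_add_right, inner_smul_left, inner_smul_right, hab,
      conj_trivial]
    ring
  have hVVO : (fun ε => ⟪V ε, V ε⟫ - (⟪b, b⟫ / 4 * ε ^ 2 + ⟪b, d⟫ / 24 * ε ^ 4))
      =O[𝓝[≠] 0] fun ε => ε ^ 6 := by
    simp only [hVV, add_sub_cancel_left]
    exact isBigO_pow_mul_of_bounded 6
      ((isBigO_one_inner (hconst b) hqO).add (isBigO_one_inner hdO hdO))
  have hSO : (fun ε => ⟪O ε, O ε⟫ + ⟪V ε, V ε⟫ - (1 - ⟪b, b⟫ / 12 * ε ^ 2))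
      =O[𝓝[≠] 0] fun ε => ε ^ 4 := by
    have h := isBigO_pow_mul_of_bounded 4
      ((((isBigO_one_inner (hconst a) hpO).const_mul_left 2).add (isBigO_one_inner hcO hcO)).add
        ((isBigO_const_const (⟪b, d⟫ / 24) (one_ne_zero (α := ℝ)) _).add (isBigO_one_smul (hε 2)
          ((isBigO_one_inner (hconst b) hqO).add (isBigO_one_inner hdO hdO)))))
    refine h.congr_left fun ε => ?_
    rw [hOO, hVV, smul_eq_mul]
    ring
  have hOVO : (fun ε => ⟪O ε, V ε⟫) =O[𝓝[≠] 0] fun ε => ε ^ 3 := by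
    simp only [hOV]
    exact isBigO_pow_mul_of_bounded 3
      (((isBigO_one_inner (hconst a) hdO).add
        ((isBigO_one_inner hcO (hconst b)).const_mul_left _)).add
        (isBigO_one_smul (hε 2) (isBigO_one_inner hcO hdO)))
  have hsub (ε : ℝ) : ‖V ε - O ε‖ ^ 2 = ⟪O ε, O ε⟫ + ⟪V ε, V ε⟫ - 2 * ⟪O ε, V ε⟫ := by
    rw [norm_sub_sq_real, ← real_inner_self_eq_norm_sq, ← real_inner_self_eq_norm_sq,
      real_inner_comm (O ε) (V ε)]
    ring
  have hadd (ε : ℝ) : ‖O ε + V ε‖ ^ 2 = ⟪O ε, O ε⟫ + ⟪V ε, V ε⟫ + 2 * ⟪O ε, V ε⟫ := by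
    rw [norm_add_sq_real, ← real_inner_self_eq_norm_sq, ← real_inner_self_eq_norm_sq]
    ring
  have hmain := isBigO_ratio_expansion hl hSO hVVO hOVO
    (N := fun ε => ‖V ε - O ε‖ * ‖O ε + V ε‖) (fun ε => by positivity)
    (fun ε => by rw [mul_pow, hsub, hadd]; ring)
  refine hmain.congr' ?_ .rfl
  filter_upwards [self_mem_nhdsWithin] with ε hε0
  have hε2 : ε ^ 2 ≠ 0 := pow_ne_zero 2 hε0
  have hnum : ⟪y (-ε), -y ε⟫ = ε ^ 2 * (⟪O ε, O ε⟫ + ⟪V ε, V ε⟫ - 2 * ⟪V ε, V ε⟫) := by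
    rw [hy₂, hy₁]
    simp only [inner_neg_right, inner_sub_left, inner_add_right, inner_smul_left,
      inner_smul_right, real_inner_comm (O ε) (V ε), conj_trivial]
    ring
  have hden : ‖y (-ε)‖ * ‖-y ε‖ = ε ^ 2 * (‖V ε - O ε‖ * ‖O ε + V ε‖) := by
    rw [norm_neg, hy₂, hy₁, norm_smul, norm_smul, ← sq_abs ε, Real.norm_eq_abs]
    ring
  rw [hnum, hden, mul_div_mul_left _ _ hε2]

end VectorExpansion

section Curve

variable {E : Type*} [NormedAddCommGroup E]

theorem ContDiff.hasDerivAt_iteratedDeriv [NormedSpace ℝ E] {x : ℝ → E}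
    (hx : ContDiff ℝ (⊤ : ℕ∞) x) (n : ℕ) (s : ℝ) :
    HasDerivAt (iteratedDeriv n x) (iteratedDeriv (n + 1) x s) s := by
  rw [iteratedDeriv_succ]
  exact (hx.differentiable_iteratedDeriv n (by exact_mod_cast ENat.natCast_lt_top n) s).hasDerivAt

/-- Fifth order Taylor expansion with bounded sixth order remainder. -/
theorem ContDiff.exists_taylor_five [NormedSpace ℝ E] {x : ℝ → E}
    (hx : ContDiff ℝ (⊤ : ℕ∞) x) (s₀ : ℝ) :
    ∃ r : ℝ → E, r =O[𝓝 0] (fun _ => (1 : ℝ)) ∧ ∀ ε, x (s₀ + ε) - x s₀ =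
      ε • deriv x s₀ + (ε ^ 2 / 2) • iteratedDeriv 2 x s₀ + (ε ^ 3 / 6) • iteratedDeriv 3 x s₀ +
        (ε ^ 4 / 24) • iteratedDeriv 4 x s₀ + (ε ^ 5 / 120) • iteratedDeriv 5 x s₀ +
        ε ^ 6 • r ε := by
  have hT := (taylor_isLittleO_univ (n := 6) (x₀ := s₀)
    (contDiff_infty.1 hx 6)).isBigO
  have htend : Filter.Tendsto (fun ε : ℝ => s₀ + ε) (𝓝 0) (𝓝 s₀) := by
    simpa using (continuous_const_add s₀).tendsto 0
  have hT' := hT.comp_tendsto htend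
  simp only [Function.comp_def, add_sub_cancel_left, taylor_within_apply,
    iteratedDerivWithin_univ, Finset.sum_range_succ, Finset.sum_range_zero] at hT'
  norm_num [Nat.factorial] at hT'
  set P : ℝ → E := fun ε => x (s₀ + ε) - x s₀ - (ε • deriv x s₀ +
    (ε ^ 2 / 2) • iteratedDeriv 2 x s₀ + (ε ^ 3 / 6) • iteratedDeriv 3 x s₀ +
    (ε ^ 4 / 24) • iteratedDeriv 4 x s₀ + (ε ^ 5 / 120) • iteratedDeriv 5 x s₀) with hP
  have hPO : P =O[𝓝 0] fun ε => ε ^ 6 := by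
    have h6 : (fun ε : ℝ => ε ^ 6 • ((1 / 720 : ℝ) • iteratedDeriv 6 x s₀)) =O[𝓝 0]
        fun ε => ε ^ 6 := by
      simpa using (isBigO_refl (fun ε : ℝ => ε ^ 6) (𝓝 0)).smul
        (isBigO_const_const ((1 / 720 : ℝ) • iteratedDeriv 6 x s₀) (one_ne_zero (α := ℝ)) (𝓝 0))
    refine (hT'.add h6).congr_left fun ε => ?_
    simp only [hP]
    module
  refine ⟨fun ε => (ε ^ 6)⁻¹ • P ε, ?_, fun ε => ?_⟩
  · have h : (fun ε : ℝ => (ε ^ 6)⁻¹ * ε ^ 6) =O[𝓝 0] fun _ => (1 : ℝ) :=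
      isBigO_of_le _ fun ε => by
        rcases eq_or_ne ε 0 with rfl | h0
        · simp
        · simp [h0]
    exact ((isBigO_refl (fun ε : ℝ => (ε ^ 6)⁻¹) (𝓝 0)).smul hPO).trans (by simpa using h)
  · rcases eq_or_ne ε 0 with rfl | h0
    · simp
    · rw [smul_inv_smul₀ (pow_ne_zero 6 h0)]
      simp only [hP]
      abel

theorem ContDiff.hasDerivAt_inner_iteratedDeriv [InnerProductSpace ℝ E] {x : ℝ → E}
    (hx : ContDiff ℝ (⊤ : ℕ∞) x) (m n : ℕ) (s : ℝ) :
    HasDerivAt (fun s => ⟪iteratedDeriv m x s, iteratedDeriv n x s⟫)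
      (⟪iteratedDeriv m x s, iteratedDeriv (n + 1) x s⟫ +
        ⟪iteratedDeriv (m + 1) x s, iteratedDeriv n x s⟫) s :=
  (hx.hasDerivAt_iteratedDeriv m s).inner ℝ (hx.hasDerivAt_iteratedDeriv n s)

end Curve

section SpaceCurve

variable {x : ℝ → E3}

theorem curv_sq (s : ℝ) : curv x s ^ 2 = ⟪iteratedDeriv 2 x s, iteratedDeriv 2 x s⟫ :=
  (real_inner_self_eq_norm_sq _).symm

theorem hasDerivAt_curv (hx : ContDiff ℝ (⊤ : ℕ∞) x) {s : ℝ} (hs : 0 < curv x s) :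
    HasDerivAt (curv x) (⟪iteratedDeriv 2 x s, iteratedDeriv 3 x s⟫ / curv x s) s := by
  have hsqrt : curv x = fun s => √⟪iteratedDeriv 2 x s, iteratedDeriv 2 x s⟫ := by
    funext s
    rw [← curv_sq, curv, Real.sqrt_sq (norm_nonneg _)]
  have h := (hx.hasDerivAt_inner_iteratedDeriv 2 2 s).sqrt (by rw [← curv_sq]; positivity)
  rw [← curv_sq, Real.sqrt_sq hs.le, ← hsqrt] at h
  convert h using 1
  rw [real_inner_comm (iteratedDeriv 2 x s) (iteratedDeriv (2 + 1) x s)]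
  field_simp
  ring

theorem curv_mul_iteratedDeriv_two_curv (hx : ContDiff ℝ (⊤ : ℕ∞) x) {s₀ : ℝ}
    (hκ : ∀ᶠ s in 𝓝 s₀, 0 < curv x s) :
    curv x s₀ * iteratedDeriv 2 (curv x) s₀ =
      ⟪iteratedDeriv 3 x s₀, iteratedDeriv 3 x s₀⟫ +
        ⟪iteratedDeriv 2 x s₀, iteratedDeriv 4 x s₀⟫ -
        ⟪iteratedDeriv 2 x s₀, iteratedDeriv 3 x s₀⟫ ^ 2 / curv x s₀ ^ 2 := by
  have hκ₀ : 0 < curv x s₀ := hκ.self_of_nhds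
  have hderiv : deriv (curv x) =ᶠ[𝓝 s₀]
      fun s => ⟪iteratedDeriv 2 x s, iteratedDeriv 3 x s⟫ / curv x s :=
    hκ.mono fun s hs => (hasDerivAt_curv hx hs).deriv
  have h := (hx.hasDerivAt_inner_iteratedDeriv 2 3 s₀).fun_div (hasDerivAt_curv hx hκ₀) hκ₀.ne'
  rw [iteratedDeriv_succ, iteratedDeriv_one, hderiv.deriv_eq, h.deriv]
  field_simp
  ring

/-- The Gram determinant of three vectors of `ℝ³` is the square of their triple product. -/
theorem inner_cross3_sq (u v w : E3) :
    ⟪cross3 u v, w⟫ ^ 2 = ⟪u, u⟫ * (⟪v, v⟫ * ⟪w, w⟫ - ⟪v, w⟫ ^ 2) -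
      ⟪u, v⟫ * (⟪u, v⟫ * ⟪w, w⟫ - ⟪v, w⟫ * ⟪u, w⟫) +
      ⟪u, w⟫ * (⟪u, v⟫ * ⟪v, w⟫ - ⟪v, v⟫ * ⟪u, w⟫) := by
  simp only [cross3, PiLp.inner_apply, Fin.sum_univ_three, RCLike.inner_apply, conj_trivial]
  simp
  ring

end SpaceCurve

theorem statement0 (x : ℝ → E3) (hx : ContDiff ℝ (⊤ : ℕ∞) x)
    (harc : ∀ s, ‖deriv x s‖ = 1) (s₀ : ℝ)
    (hκ : ∀ᶠ s in 𝓝 s₀, 0 < curv x s) :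
    (fun ε : ℝ =>
        ⟪x (s₀ - ε) - x s₀, x s₀ - x (s₀ + ε)⟫ /
            (‖x (s₀ - ε) - x s₀‖ * ‖x s₀ - x (s₀ + ε)‖) -
          (1 - curv x s₀ ^ 2 / 2 * ε ^ 2 +
            (curv x s₀ ^ 4 / 24 + curv x s₀ ^ 2 * tors x s₀ ^ 2 / 12 -
                curv x s₀ * iteratedDeriv 2 (curv x) s₀ / 12) * ε ^ 4))
      =O[𝓝[≠] (0 : ℝ)] fun ε => ε ^ 6 := by
  have haa (s : ℝ) : ⟪iteratedDeriv 1 x s, iteratedDeriv 1 x s⟫ = 1 := by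
    rw [iteratedDeriv_one, real_inner_self_eq_norm_sq, harc, one_pow]
  have hab (s : ℝ) : ⟪iteratedDeriv 1 x s, iteratedDeriv 2 x s⟫ = 0 := by
    have h := hx.hasDerivAt_inner_iteratedDeriv 1 1 s
    simp only [haa] at h
    have h0 := h.unique (hasDerivAt_const s 1)
    rw [real_inner_comm (iteratedDeriv 1 x s)] at h0
    exact self_eq_neg.1 (eq_neg_of_add_eq_zero_left h0)
  have hac (s : ℝ) : ⟪iteratedDeriv 1 x s, iteratedDeriv 3 x s⟫ =
      -⟪iteratedDeriv 2 x s, iteratedDeriv 2 x s⟫ := by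
    have h := hx.hasDerivAt_inner_iteratedDeriv 1 2 s
    simp only [hab] at h
    have h0 := h.unique (hasDerivAt_const s 0)
    exact eq_neg_of_add_eq_zero_left h0
  have hκ₀ : 0 < curv x s₀ := hκ.self_of_nhds
  have hτ : curv x s₀ ^ 2 * tors x s₀ ^ 2 = ⟪iteratedDeriv 3 x s₀, iteratedDeriv 3 x s₀⟫ -
      ⟪iteratedDeriv 2 x s₀, iteratedDeriv 3 x s₀⟫ ^ 2 / curv x s₀ ^ 2 - curv x s₀ ^ 4 := by
    rw [tors, div_pow, inner_cross3_sq, ← iteratedDeriv_one, haa, hab, hac, ← curv_sq]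
    field_simp
    ring
  have hκ'' := curv_mul_iteratedDeriv_two_curv hx hκ
  obtain ⟨r, hr, hy⟩ := hx.exists_taylor_five s₀
  rw [← iteratedDeriv_one] at hy
  refine (isBigO_cos_chords (y := fun ε => x (s₀ + ε) - x s₀) hr hy (haa s₀) (hab s₀)
    (hac s₀)).congr_left fun ε => ?_
  rw [neg_sub, ← sub_eq_add_neg, hτ, hκ'', ← curv_sq]
  ring
end
end

section
/- Let x : ℝ → ℝ³ be a C^∞ curve parametrized by arclength and fix s₀ with κ(s₀) > 0. Set x_j = x(s₀ + (j−3)ε) for j = 1,…,5. Let N₁(ε) = (x₂−x₃) × (x₁−x₃) and N₂(ε) = (x₅−x₃) × (x₄−x₃) be normal vectors of the planes through (x₁,x₂,x₃) and (x₃,x₄,x₅). Then, as ε → 0 (ε ≠ 0), ⟨N₁, N₂⟩/(‖N₁‖·‖N₂‖) = 1 − 2·τ(s₀)²·ε² + O(ε⁴). -/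
open scoped RealInnerProductSpace Topology
open Asymptotics

noncomputable section

open Filter

theorem isBigO_pow_pow_nhdsNE_zero {m n : ℕ} (h : m ≤ n) :
    (fun t : ℝ => t ^ n) =O[𝓝[≠] 0] fun t => t ^ m :=
  (IsBigO.of_bound 1 (by
    filter_upwards [Metric.ball_mem_nhds (0 : ℝ) one_pos] with t ht
    rw [mem_ball_zero_iff] at ht
    simpa using pow_le_pow_of_le_one (abs_nonneg t) ht.le h)).mono nhdsWithin_le_nhds

/-- Second-order expansion of `(a - b) / √((a + b) ^ 2 - 4 * c ^ 2)` for `b = O(t ^ 2)` and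
`c = O(t)`. -/
theorem sub_div_sqrt_expansion {a b c d : ℝ → ℝ} {a₀ b₀ c₀ : ℝ} (ha₀ : 0 < a₀)
    (ha : (fun t => a t - a₀) =O[𝓝[≠] 0] fun t => t ^ 2)
    (hb : (fun t => b t - t ^ 2 * b₀) =O[𝓝[≠] 0] fun t => t ^ 4)
    (hc : (fun t => c t - t * c₀) =O[𝓝[≠] 0] fun t => t ^ 3)
    (hd : ∀ t, 0 ≤ d t) (hd2 : ∀ t, d t ^ 2 = (a t + b t) ^ 2 - 4 * c t ^ 2) :
    (fun t => (a t - b t) / d t - (1 - 2 * ((a₀ * b₀ - c₀ ^ 2) / a₀ ^ 2) * t ^ 2))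
      =O[𝓝[≠] 0] fun t => t ^ 4 := by
  set l : Filter ℝ := 𝓝[≠] 0
  have hpow : ∀ {m n : ℕ}, m ≤ n → (fun t : ℝ => t ^ n) =O[l] fun t => t ^ m :=
    fun h => isBigO_pow_pow_nhdsNE_zero h
  have hone : ∀ {f : ℝ → ℝ} {y : ℝ}, Tendsto f l (𝓝 y) → f =O[l] fun _ => (1 : ℝ) :=
    fun h => h.isBigO_one ℝ
  have hpow0 : ∀ {n : ℕ}, n ≠ 0 → Tendsto (fun t : ℝ => t ^ n) l (𝓝 0) := fun {n} hn => by
    have : Tendsto (fun t : ℝ => t ^ n) (𝓝 0) (𝓝 0) := by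
      simpa [hn] using (continuous_pow n).tendsto (0 : ℝ)
    exact this.mono_left nhdsWithin_le_nhds
  have hbO : b =O[l] fun t => t ^ 2 := by
    have h := (hb.trans (hpow (by norm_num : 2 ≤ 4))).add
      ((isBigO_refl (fun t : ℝ => t ^ 2) l).const_mul_left b₀)
    exact h.congr_left fun t => by ring
  have hcO : c =O[l] fun t => t ^ 1 := by
    have h := (hc.trans (hpow (by norm_num : 1 ≤ 3))).add
      ((isBigO_refl (fun t : ℝ => t ^ 1) l).const_mul_left c₀)
    exact h.congr_left fun t => by ring
  have haT : Tendsto a l (𝓝 a₀) := by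
    simpa using (ha.trans_tendsto (hpow0 two_ne_zero)).add_const a₀
  have hbT : Tendsto b l (𝓝 0) := hbO.trans_tendsto (hpow0 two_ne_zero)
  have hcT : Tendsto c l (𝓝 0) := hcO.trans_tendsto (hpow0 one_ne_zero)
  have hdsq : d = fun t => √((a t + b t) ^ 2 - 4 * c t ^ 2) := by
    funext t; rw [← hd2, Real.sqrt_sq (hd t)]
  have hdT : Tendsto d l (𝓝 a₀) := by
    rw [hdsq]
    have h := (((haT.add hbT).pow 2).sub ((hcT.pow 2).const_mul 4)).sqrt
    simpa [Real.sqrt_sq ha₀.le] using h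
  set k : ℝ → ℝ := fun t => (a t - b t) / d t with hk
  have hkT : Tendsto k l (𝓝 1) := by
    have h := (haT.sub hbT).div hdT ha₀.ne'
    rwa [sub_zero, div_self ha₀.ne'] at h
  have hdpos : ∀ᶠ t in l, 0 < d t := hdT.eventually (lt_mem_nhds ha₀)
  have hkpos : ∀ᶠ t in l, 0 < k t := hkT.eventually (lt_mem_nhds one_pos)
  have hq : (fun t => (a t * b t - c t ^ 2) - t ^ 2 * (a₀ * b₀ - c₀ ^ 2)) =O[l]
      fun t => t ^ 4 := by
    have h₁ := (hone haT).mul hb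
    have h₂ := (ha.mul (isBigO_refl (fun t : ℝ => t ^ 2) l)).const_mul_left b₀
    have h₃ := hc.mul (hcO.add ((isBigO_refl (fun t : ℝ => t ^ 1) l).const_mul_left c₀))
    refine (((h₁.congr_right fun t => ?_).add (h₂.congr_right fun t => ?_)).sub
      (h₃.congr_right fun t => ?_)).congr_left fun t => ?_
    all_goals ring
  have hqO : (fun t => a t * b t - c t ^ 2) =O[l] fun t => t ^ 2 := by
    have h := (hq.trans (hpow (by norm_num : 2 ≤ 4))).add
      ((isBigO_refl (fun t : ℝ => t ^ 2) l).const_mul_left (a₀ * b₀ - c₀ ^ 2))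
    exact h.congr_left fun t => by ring
  have hdO : (fun t => d t ^ 2 - a₀ ^ 2) =O[l] fun t => t ^ 2 := by
    have h₁ := ha.mul (hone (haT.add_const a₀))
    have h₂ := hbO.mul (hone ((haT.const_mul 2).add hbT))
    have h₃ := (hcO.mul hcO).const_mul_left 4
    refine (((h₁.congr_right fun t => ?_).add (h₂.congr_right fun t => ?_)).sub
      (h₃.congr_right fun t => ?_)).congr_left fun t => ?_
    on_goal 4 => rw [hd2]
    all_goals ring
  have hXinv : (fun t => (d t ^ 2 * (1 + k t))⁻¹) =O[l] fun _ => (1 : ℝ) :=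
    hone (((hdT.pow 2).mul (hkT.const_add 1)).inv₀ (by positivity))
  have hkeq : ∀ᶠ t in l, k t - 1 = -4 * (a t * b t - c t ^ 2) * (d t ^ 2 * (1 + k t))⁻¹ := by
    filter_upwards [hdpos, hkpos] with t h₁ h₂
    have hkd : k t * d t = a t - b t := div_mul_cancel₀ _ h₁.ne'
    rw [← div_eq_mul_inv, eq_div_iff (by positivity)]
    linear_combination (k t * d t + (a t - b t)) * hkd - hd2 t
  have hkO : (fun t => k t - 1) =O[l] fun t => t ^ 2 := by
    have h := (hqO.const_mul_left (-4)).mul hXinv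
    exact (h.congr' (hkeq.mono fun _ ht => ht.symm)
      (Eventually.of_forall fun t => by simp))
  have hX : (fun t => d t ^ 2 * (1 + k t) - 2 * a₀ ^ 2) =O[l] fun t => t ^ 2 := by
    have h := (hdO.mul (hone (hkT.const_add 1))).add ((hkO.const_mul_left (a₀ ^ 2)).mul
      (isBigO_refl (fun _ => (1 : ℝ)) l))
    exact h.congr (fun t => by ring) fun t => by ring
  have h₁ := (hq.const_mul_left (-4)).mul hXinv
  have h₂ := (((isBigO_refl (fun t : ℝ => t ^ 2) l).mul hX).const_mul_left
    (2 * (a₀ * b₀ - c₀ ^ 2) / a₀ ^ 2)).mul hXinv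
  refine ((h₁.congr_right fun t => ?_).add (h₂.congr_right fun t => ?_)).congr'
    ?_ EventuallyEq.rfl
  · ring
  · ring
  · filter_upwards [hdpos, hkpos, hkeq] with t p₁ p₂ p₃
    have p₄ : 0 < d t ^ 2 * (1 + k t) := by positivity
    rw [show (a t - b t) / d t = 1 + (k t - 1) by simp [hk], p₃]
    field_simp
    ring

/-- Error estimate for an inner product whose factors are known up to `O(f)` and `O(g)`. -/
theorem isBigO_inner_sub_inner {F : Type*} [NormedAddCommGroup F] [InnerProductSpace ℝ F]
    {l : Filter ℝ} {u u' v v' : ℝ → F} {f g h k m : ℝ → ℝ}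
    (hu : (fun t => u t - u' t) =O[l] f) (hv : (fun t => v t - v' t) =O[l] g)
    (hvh : v =O[l] h) (hu' : u' =O[l] k)
    (h₁ : (fun t => f t * h t) =O[l] m) (h₂ : (fun t => k t * g t) =O[l] m) :
    (fun t => ⟪u t, v t⟫ - ⟪u' t, v' t⟫) =O[l] m := by
  have e : (fun t => ⟪u t, v t⟫ - ⟪u' t, v' t⟫)
      = fun t => ⟪u t - u' t, v t⟫ + ⟪u' t, v t - v' t⟫ := by
    funext t; simp only [inner_sub_left, inner_sub_right]; ring
  have hin : ∀ p q : ℝ → F, (fun t => ⟪p t, q t⟫) =O[l] fun t => ‖p t‖ * ‖q t‖ := fun p q =>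
    IsBigO.of_bound 1 (Eventually.of_forall fun t => by
      simpa using norm_inner_le_norm (𝕜 := ℝ) (p t) (q t))
  rw [e]
  exact (((hin _ _).trans (hu.norm_left.mul hvh.norm_left)).trans h₁).add
    (((hin _ _).trans (hu'.norm_left.mul hv.norm_left)).trans h₂)

/-- Second-order expansion of the cosine of the angle between `V (-t)` and `V t`. -/
theorem cos_angle_reflection_expansion {F : Type*} [NormedAddCommGroup F] [InnerProductSpace ℝ F]
    {V : ℝ → F} {V₀ V₁ V₂ : F} (hV₀ : V₀ ≠ 0)
    (hV : (fun t => V t - (V₀ + t • V₁ + t ^ 2 • V₂)) =O[𝓝[≠] 0] fun t => t ^ 3) :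
    (fun t => ⟪V (-t), V t⟫ / (‖V (-t)‖ * ‖V t‖)
        - (1 - 2 * ((‖V₀‖ ^ 2 * ‖V₁‖ ^ 2 - ⟪V₀, V₁⟫ ^ 2) / ‖V₀‖ ^ 4) * t ^ 2))
      =O[𝓝[≠] 0] fun t => t ^ 4 := by
  set l : Filter ℝ := 𝓝[≠] 0
  have hpow : ∀ {m n : ℕ}, m ≤ n → (fun t : ℝ => t ^ n) =O[l] fun t => t ^ m :=
    fun h => isBigO_pow_pow_nhdsNE_zero h
  have hneg : Tendsto (fun t : ℝ => -t) l l := by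
    refine tendsto_nhdsWithin_iff.2 ⟨?_, ?_⟩
    · have : Tendsto (fun t : ℝ => -t) (𝓝 0) (𝓝 0) := by simpa using (continuous_neg.tendsto (0:ℝ))
      exact this.mono_left nhdsWithin_le_nhds
    · filter_upwards [self_mem_nhdsWithin] with t ht
      simpa using ht
  have hW : (fun t => V (-t) - (V₀ - t • V₁ + t ^ 2 • V₂)) =O[l] fun t => t ^ 3 := by
    have h := (hV.comp_tendsto hneg).neg_right
    refine h.congr (fun t => ?_) fun t => ?_
    · simp [sub_eq_add_neg]
    · simp [Odd.neg_pow (by decide : Odd 3)]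
  set S : ℝ → F := fun t => (1 / 2 : ℝ) • (V t + V (-t)) with hS
  set D : ℝ → F := fun t => (1 / 2 : ℝ) • (V t - V (-t)) with hD
  have hsmul : ∀ (n : ℕ) (v : F), (fun t : ℝ => t ^ n • v) =O[l] fun t => t ^ n := fun n v =>
    IsBigO.of_bound ‖v‖ (Eventually.of_forall fun t => by rw [norm_smul, mul_comm])
  have hS₀ : (fun t => S t - V₀) =O[l] fun t => t ^ 2 := by
    have h := (((hV.add hW).const_smul_left (1 / 2 : ℝ)).trans (hpow (by norm_num : 2 ≤ 3))).add
      (hsmul 2 V₂)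
    refine h.congr_left fun t => ?_
    simp only [hS, Pi.smul_apply]; module
  have hD₁ : (fun t => D t - t ^ 1 • V₁) =O[l] fun t => t ^ 3 := by
    have h := ((hV.sub hW).const_smul_left (1 / 2 : ℝ))
    refine h.congr_left fun t => ?_
    simp only [hD, Pi.smul_apply]; module
  have hSO : S =O[l] fun t => t ^ 0 := by
    have h := (hS₀.trans (hpow (Nat.zero_le 2))).add (hsmul 0 V₀)
    exact h.congr_left fun t => by simp
  have hDO : D =O[l] fun t => t ^ 1 := by
    have h := (hD₁.trans (hpow (by norm_num : 1 ≤ 3))).add (hsmul 1 V₁)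
    exact h.congr_left fun t => by simp
  have hV₀O : (fun _ : ℝ => V₀) =O[l] fun t => t ^ 0 := by simpa using hsmul 0 V₀
  have ha : (fun t => ⟪S t, S t⟫ - ⟪V₀, V₀⟫) =O[l] fun t => t ^ 2 :=
    isBigO_inner_sub_inner hS₀ hS₀ hSO hV₀O
      (by simpa using isBigO_refl _ _) (by simpa using isBigO_refl _ _)
  have hb : (fun t => ⟪D t, D t⟫ - t ^ 2 * ⟪V₁, V₁⟫) =O[l] fun t => t ^ 4 := by
    refine (isBigO_inner_sub_inner hD₁ hD₁ hDO (hsmul 1 V₁) (m := fun t => t ^ 4)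
      ?_ ?_).congr_left fun t => ?_
    · exact (isBigO_refl _ _).congr_left fun t => by ring
    · exact (isBigO_refl _ _).congr_left fun t => by ring
    · rw [real_inner_smul_left V₁, real_inner_smul_right V₁]; ring
  have hc : (fun t => ⟪S t, D t⟫ - t * ⟪V₀, V₁⟫) =O[l] fun t => t ^ 3 := by
    refine (isBigO_inner_sub_inner hS₀ hD₁ hDO hV₀O (m := fun t => t ^ 3)
      ?_ ?_).congr_left fun t => ?_
    · exact (isBigO_refl _ _).congr_left fun t => by ring
    · exact (isBigO_refl _ _).congr_left fun t => by ring
    · rw [real_inner_smul_right V₀]; ring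
  have h := sub_div_sqrt_expansion (d := fun t => ‖V (-t)‖ * ‖V t‖)
    (real_inner_self_pos.2 hV₀) ha hb hc (fun t => by positivity) fun t => ?_
  · refine h.congr_left fun t => ?_
    rw [show ⟪S t, S t⟫ - ⟪D t, D t⟫ = ⟪V (-t), V t⟫ by
      simp only [hS, hD, real_inner_smul_left, real_inner_smul_right, inner_add_left,
        inner_add_right, inner_sub_left, inner_sub_right, real_inner_comm (V (-t)) (V t)]
      ring]
    simp only [real_inner_self_eq_norm_sq]
    ring
  · rw [mul_pow, ← real_inner_self_eq_norm_sq, ← real_inner_self_eq_norm_sq]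
    simp only [hS, hD, real_inner_smul_left, real_inner_smul_right, inner_add_left,
      inner_add_right, inner_sub_left, inner_sub_right, real_inner_comm (V (-t)) (V t)]
    ring

/-- The cosine of an angle is unchanged when both vectors are scaled by the same factor. -/
theorem inner_smul_smul_div_norm_mul_norm {F : Type*} [NormedAddCommGroup F]
    [InnerProductSpace ℝ F] {r : ℝ} (hr : r ≠ 0) (u v : F) :
    ⟪r • u, r • v⟫ / (‖r • u‖ * ‖r • v‖) = ⟪u, v⟫ / (‖u‖ * ‖v‖) := by
  rw [real_inner_smul_left, real_inner_smul_right, norm_smul, norm_smul, ← mul_assoc,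
    mul_mul_mul_comm, ← norm_mul, Real.norm_of_nonneg (mul_self_nonneg r),
    mul_div_mul_left _ _ (mul_self_ne_zero.2 hr)]

theorem inner_cross3_cross3 (a b c d : E3) :
    ⟪cross3 a b, cross3 c d⟫ = ⟪a, c⟫ * ⟪b, d⟫ - ⟪a, d⟫ * ⟪b, c⟫ := by
  simp [cross3, PiLp.inner_apply, Fin.sum_univ_three]
  ring

theorem norm_cross3_sq (a b : E3) :
    ‖cross3 a b‖ ^ 2 = ‖a‖ ^ 2 * ‖b‖ ^ 2 - ⟪a, b⟫ ^ 2 := by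
  simp only [← real_inner_self_eq_norm_sq, inner_cross3_cross3, real_inner_comm a b]
  ring

theorem norm_cross3_le (a b : E3) : ‖cross3 a b‖ ≤ ‖a‖ * ‖b‖ := by
  refine (sq_le_sq₀ (norm_nonneg _) (by positivity)).1 ?_
  nlinarith [norm_cross3_sq a b, sq_nonneg ⟪a, b⟫]

/-- The Gram determinant of `a × b` and `a × c` in terms of the triple product. -/
theorem gram_cross3_cross3 (a b c : E3) :
    ‖cross3 a b‖ ^ 2 * ‖cross3 a c‖ ^ 2 - ⟪cross3 a b, cross3 a c⟫ ^ 2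
      = ‖a‖ ^ 2 * ⟪cross3 a b, c⟫ ^ 2 := by
  simp only [EuclideanSpace.real_norm_sq_eq]
  simp [cross3, PiLp.inner_apply, Fin.sum_univ_three]
  ring

theorem isBigO_cross3 {l : Filter ℝ} {u v : ℝ → E3} {f g : ℝ → ℝ}
    (hu : u =O[l] f) (hv : v =O[l] g) :
    (fun t => cross3 (u t) (v t)) =O[l] fun t => f t * g t :=
  (IsBigO.of_bound 1 (Eventually.of_forall fun t => by
    simpa using norm_cross3_le (u t) (v t))).trans (hu.norm_left.mul hv.norm_left)

/-- Expansion of `y (2 * t) × y t` from the fourth-order Taylor expansion of `y`. -/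
theorem cross3_expansion {y : ℝ → E3} {T A B C : E3}
    (hy : (fun t => y t - (t • T + (t ^ 2 / 2) • A + (t ^ 3 / 6) • B + (t ^ 4 / 24) • C))
      =O[𝓝 0] fun t => t ^ 5) :
    (fun t => cross3 (y (2 * t)) (y t) - (t ^ 3 • -cross3 T A + t ^ 4 • -cross3 T B
      + t ^ 5 • (-(7 / 12 : ℝ) • cross3 T C - (1 / 3 : ℝ) • cross3 A B)))
      =O[𝓝 0] fun t => t ^ 6 := by
  set P : ℝ → E3 := fun t => t • T + (t ^ 2 / 2) • A + (t ^ 3 / 6) • B + (t ^ 4 / 24) • C with hP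
  have hone : ∀ {f : ℝ → E3}, Continuous f → f =O[𝓝 0] fun _ => (1 : ℝ) :=
    fun h => (h.tendsto 0).isBigO_one ℝ
  have hdouble : Tendsto (fun t : ℝ => 2 * t) (𝓝 0) (𝓝 0) := by
    simpa using (continuous_const_mul (2 : ℝ)).tendsto 0
  have hy₂ : (fun t => y (2 * t) - P (2 * t)) =O[𝓝 0] fun t => t ^ 5 := by
    refine (hy.comp_tendsto hdouble).trans (IsBigO.of_bound 32 (Eventually.of_forall fun t => ?_))
    simp only [Function.comp, mul_pow, norm_mul]
    norm_num
  have hPO : P =O[𝓝 0] fun t => t := by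
    have h := (isBigO_refl (fun t : ℝ => t) (𝓝 0)).smul (hone
      (f := fun t => T + (t / 2) • A + (t ^ 2 / 6) • B + (t ^ 3 / 24) • C) (by fun_prop))
    refine h.congr (fun t => ?_) fun t => by simp
    simp only [hP]; module
  have hP₂O : (fun t => P (2 * t)) =O[𝓝 0] fun t => t :=
    (hPO.comp_tendsto hdouble).trans ((isBigO_refl _ _).const_mul_left 2)
  have hpow : (fun t : ℝ => t ^ 5) =O[𝓝 0] fun t => t := by
    refine ((isBigO_refl (fun t : ℝ => t) (𝓝 0)).mul
      (((continuous_pow 4).tendsto (0 : ℝ)).isBigO_one ℝ)).congr ?_ ?_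
    · intro t; ring
    · intro t; ring
  have hyO : y =O[𝓝 0] fun t => t :=
    ((hy.trans hpow).add hPO).congr_left fun t => sub_add_cancel _ _
  have h₁ := isBigO_cross3 hy₂ hyO
  have h₂ := isBigO_cross3 hP₂O hy
  have h₃ := (isBigO_refl (fun t : ℝ => t ^ 6) (𝓝 0)).smul (hone
    (f := fun t => -(1 / 4 : ℝ) • cross3 A C - (t / 18) • cross3 B C) (by fun_prop))
  refine (((h₁.congr_right fun t => ?_).add (h₂.congr_right fun t => ?_)).add
    (h₃.congr_right fun t => ?_)).congr_left fun t => ?_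
  · ring
  · ring
  · simp
  · ext i
    fin_cases i <;> simp [cross3, hP] <;> ring

theorem curve_expansion {x : ℝ → E3} (hx : ContDiff ℝ (⊤ : ℕ∞) x) (s₀ : ℝ) :
    (fun t => (x (s₀ + t) - x s₀) - (t • deriv x s₀ + (t ^ 2 / 2) • iteratedDeriv 2 x s₀
      + (t ^ 3 / 6) • iteratedDeriv 3 x s₀ + (t ^ 4 / 24) • iteratedDeriv 4 x s₀))
      =O[𝓝 0] fun t => t ^ 5 := by
  have h := (taylor_isLittleO_univ (x₀ := s₀) (n := 5) (contDiff_infty.1 hx 5)).isBigO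
  have hs : Tendsto (fun t => s₀ + t) (𝓝 0) (𝓝 s₀) := by
    simpa using (continuous_const_add s₀).tendsto 0
  have h₅ : (fun t : ℝ => (t ^ 5 / 120) • iteratedDeriv 5 x s₀) =O[𝓝 0] fun t => t ^ 5 :=
    IsBigO.of_bound (‖iteratedDeriv 5 x s₀‖ / 120) (Eventually.of_forall fun t => by
      rw [norm_smul, norm_div]; norm_num; apply le_of_eq; ring)
  refine ((h.comp_tendsto hs).congr_right (fun t => ?_)).add h₅ |>.congr_left fun t => ?_
  · simp
  · simp only [Function.comp, taylor_within_apply, iteratedDerivWithin_univ,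
      Finset.sum_range_succ, Finset.sum_range_zero, iteratedDeriv_zero, iteratedDeriv_one,
      Nat.factorial, add_sub_cancel_left]
    push_cast
    module

theorem inner_deriv_iteratedDeriv_two {x : ℝ → E3} (hx : ContDiff ℝ (⊤ : ℕ∞) x)
    (harc : ∀ s, ‖deriv x s‖ = 1) (s : ℝ) : ⟪deriv x s, iteratedDeriv 2 x s⟫ = 0 := by
  have hd : HasDerivAt (deriv x) (iteratedDeriv 2 x s) s := by
    rw [iteratedDeriv_succ, iteratedDeriv_one]
    have h : ContDiff ℝ 1 (deriv x) := by
      have h := (contDiff_infty.1 hx 2).iterate_deriv' 1 1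
      simpa using h
    exact (h.differentiable one_ne_zero s).hasDerivAt
  have h := hd.inner ℝ hd
  have hc : (fun t => ⟪deriv x t, deriv x t⟫) = fun _ => (1 : ℝ) := by
    funext t; simp [harc]
  rw [hc] at h
  have h := h.unique (hasDerivAt_const s (1 : ℝ))
  rw [real_inner_comm (deriv x s)] at h
  linarith

theorem statement1 (x : ℝ → E3) (hx : ContDiff ℝ (⊤ : ℕ∞) x)
    (harc : ∀ s, ‖deriv x s‖ = 1) (s₀ : ℝ) (hκ : 0 < curv x s₀)
    (N₁ N₂ : ℝ → E3)
    -- `x₁ = x(s₀-2ε), x₂ = x(s₀-ε), x₃ = x(s₀), x₄ = x(s₀+ε), x₅ = x(s₀+2ε)`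
    (hN₁ : ∀ ε, N₁ ε = cross3 (x (s₀ - ε) - x s₀) (x (s₀ - 2 * ε) - x s₀))
    (hN₂ : ∀ ε, N₂ ε = cross3 (x (s₀ + 2 * ε) - x s₀) (x (s₀ + ε) - x s₀)) :
    (fun ε : ℝ =>
        ⟪N₁ ε, N₂ ε⟫ / (‖N₁ ε‖ * ‖N₂ ε‖) - (1 - 2 * tors x s₀ ^ 2 * ε ^ 2))
      =O[𝓝[≠] (0 : ℝ)] fun ε => ε ^ 4 := by
  set T := deriv x s₀
  set A := iteratedDeriv 2 x s₀
  set B := iteratedDeriv 3 x s₀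
  set y : ℝ → E3 := fun t => x (s₀ + t) - x s₀ with hy
  set V : ℝ → E3 := fun t => (t ^ 3)⁻¹ • cross3 (y (2 * t)) (y t) with hV
  have hTA : ‖cross3 T A‖ ^ 2 = curv x s₀ ^ 2 := by
    rw [norm_cross3_sq, harc, inner_deriv_iteratedDeriv_two hx harc, curv]
    ring
  have hV₀ : -cross3 T A ≠ 0 := by
    rw [neg_ne_zero, ← norm_ne_zero_iff, ← pow_ne_zero_iff two_ne_zero, hTA]
    positivity
  have hexp := cross3_expansion (curve_expansion hx s₀)
  have hVexp := ((isBigO_refl (fun t : ℝ => (t ^ 3)⁻¹) (𝓝[≠] 0)).smul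
    (hexp.mono nhdsWithin_le_nhds)).congr' (g₂ := fun t => t ^ 3)
    (f₂ := fun t => V t - (-cross3 T A + t • -cross3 T B + t ^ 2 •
      (-(7 / 12 : ℝ) • cross3 T (iteratedDeriv 4 x s₀) - (1 / 3 : ℝ) • cross3 A B)))
    (by
      filter_upwards [self_mem_nhdsWithin] with t ht
      have ht : t ≠ 0 := ht
      have e₃ : (t ^ 3)⁻¹ * t ^ 3 = 1 := by field_simp
      have e₄ : (t ^ 3)⁻¹ * t ^ 4 = t := by field_simp
      have e₅ : (t ^ 3)⁻¹ * t ^ 5 = t ^ 2 := by field_simp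
      rw [smul_sub, smul_add, smul_add, smul_smul, smul_smul, smul_smul, e₃, e₄, e₅, one_smul])
    (by
      filter_upwards [self_mem_nhdsWithin] with t ht
      have ht : t ≠ 0 := ht
      simp only [smul_eq_mul]
      field_simp)
  have hτ : (‖-cross3 T A‖ ^ 2 * ‖-cross3 T B‖ ^ 2 - ⟪-cross3 T A, -cross3 T B⟫ ^ 2)
      / ‖-cross3 T A‖ ^ 4 = tors x s₀ ^ 2 := by
    rw [inner_neg_neg, norm_neg, norm_neg, gram_cross3_cross3, harc,
      show ‖cross3 T A‖ ^ 4 = (‖cross3 T A‖ ^ 2) ^ 2 by ring, hTA, tors]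
    ring
  refine (cos_angle_reflection_expansion hV₀ hVexp).congr' ?_ EventuallyEq.rfl
  filter_upwards [self_mem_nhdsWithin] with t ht
  have ht : t ≠ 0 := ht
  have h₂ : N₂ t = t ^ 3 • V t := by
    rw [hN₂, hV, smul_inv_smul₀ (pow_ne_zero 3 ht)]
  have h₁ : N₁ t = t ^ 3 • V (-t) := by
    have e : t ^ 3 • V (-t) = -cross3 (y (2 * -t)) (y (-t)) := by
      simp only [hV, Odd.neg_pow (by decide : Odd 3), inv_neg, neg_smul, smul_neg]
      rw [smul_inv_smul₀ (pow_ne_zero 3 ht)]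
    rw [e, hN₁]
    ext i
    fin_cases i <;> simp [cross3, hy, sub_eq_add_neg] <;> ring
  rw [hτ, h₁, h₂, inner_smul_smul_div_norm_mul_norm (pow_ne_zero 3 ht)]
end
end

section
/- For four pairwise distinct points x₁, x₂, x₃, x₄ ∈ ℝ³, writing x_{ij} = |x_i − x_j|, one has tLast(x₁,x₂,x₃) · tMid(x₂,x₃,x₄) = (x₁₃²·x₂₄² + x₃₄²·x₁₂² − x₂₃²·x₁₄²) / (2·x₁₂·x₂₄·x₁₃·x₃₄), i.e. the cosine of the cusp angle at x₃ between the circumcircle of (x₁,x₂,x₃) and the circumcircle of (x₂,x₃,x₄) is given by this distance formula. -/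
open scoped RealInnerProductSpace Topology
open Asymptotics

noncomputable section

/-- Oriented unit tangent vector of the circumcircle of `(a, m, b)` at `a`. -/
def tFirst (a m b : E3) : E3 :=
  (1 / dist m b) • ((dist a b / dist a m) • (m - a) + (dist a m / dist a b) • (a - b))

/-- Oriented unit tangent vector of the circumcircle of `(a, m, b)` at `m`. -/
def tMid (a m b : E3) : E3 :=
  (1 / dist a b) • ((dist a m / dist m b) • (b - m) + (dist m b / dist a m) • (m - a))

/-- Oriented unit tangent vector of the circumcircle of `(a, m, b)` at `b`. -/
def tLast (a m b : E3) : E3 :=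
  (1 / dist a m) • ((dist m b / dist a b) • (a - b) + (dist a b / dist m b) • (b - m))

/-- Polarization: the inner product of two difference vectors based at `c`, through distances. -/
theorem inner_sub_sub_eq_dist {V : Type*} [NormedAddCommGroup V] [InnerProductSpace ℝ V]
    (a b c : V) :
    ⟪a - c, b - c⟫ = (dist a c ^ 2 + dist b c ^ 2 - dist a b ^ 2) / 2 := by
  have h := norm_sub_sq_real (a - c) (b - c)
  rw [sub_sub_sub_cancel_right] at h
  simp only [dist_eq_norm]
  linarith

theorem statement2 (x₁ x₂ x₃ x₄ : E3)
    (h12 : x₁ ≠ x₂) (h13 : x₁ ≠ x₃) (h14 : x₁ ≠ x₄)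
    (h23 : x₂ ≠ x₃) (h24 : x₂ ≠ x₄) (h34 : x₃ ≠ x₄) :
    ⟪tLast x₁ x₂ x₃, tMid x₂ x₃ x₄⟫ =
      (dist x₁ x₃ ^ 2 * dist x₂ x₄ ^ 2 + dist x₃ x₄ ^ 2 * dist x₁ x₂ ^ 2 -
          dist x₂ x₃ ^ 2 * dist x₁ x₄ ^ 2) /
        (2 * dist x₁ x₂ * dist x₂ x₄ * dist x₁ x₃ * dist x₃ x₄) := by
  have p12 := dist_ne_zero.mpr h12
  have p13 := dist_ne_zero.mpr h13
  have p23 := dist_ne_zero.mpr h23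
  have p24 := dist_ne_zero.mpr h24
  have p34 := dist_ne_zero.mpr h34
  unfold tLast tMid
  rw [← neg_sub x₂ x₃]
  simp only [inner_add_left, inner_add_right, real_inner_smul_left, real_inner_smul_right,
    inner_neg_left, inner_neg_right, inner_sub_sub_eq_dist, dist_self, dist_comm x₄ x₃]
  field_simp
  ring
end
end

section
/- Let κ, τ : ℝ → ℝ be C⁴ functions and s₀ ∈ ℝ such that ν(s) = √(κ'(s)² + κ(s)²τ(s)²) > 0 on a neighborhood of s₀. Define Q = (4(ν'' − κ²ν)ν − 5ν'²)/(8ν³), T = (2κ'²τ + κ²τ³ + κκ'τ' − κκ''τ)/ν^{5/2}, and P = [2κτκ'²(20κ'τ' − 19τκ'') + 2κ³τ³(5κ'τ' − 4τκ'') + κ'²(28τ²κ'² − 5κ''² + 4κ'κ''') + κ²(19τ⁴κ'² − 4κ'⁴ + 10κ'²τ'² + 2τκ'(2κ'τ'' − 15τ'κ'') + 2τ²(5κ''² + 2κ'κ''')) + κ⁴τ²(6τ⁴ − 8κ'² − 5τ'² + 4ττ'') − 4κ⁶τ⁴] / (192·ν⁵). Then P(s₀) = (1/24)·(Q(s₀)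 + (3/4)·T(s₀)²). -/
open scoped Topology

noncomputable section

/-- First derivative of the square root of a differentiable function, at a point of positivity. -/
theorem hasDerivAt_of_eq_sqrt {f f' ν : ℝ → ℝ} (hf : ∀ s, HasDerivAt f (f' s) s)
    (hν : ∀ s, ν s = √(f s)) {s : ℝ} (hs : 0 < ν s) :
    HasDerivAt ν (f' s / (2 * ν s)) s := by
  have hfs : f s ≠ 0 := (Real.sqrt_pos.mp (hν s ▸ hs)).ne'
  obtain rfl : ν = fun s => √(f s) := funext hν
  exact (hf s).sqrt hfs

/-- Second derivative of the square root of a twice differentiable function, at a point with a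
neighborhood of positivity. -/
theorem iteratedDeriv_two_of_eq_sqrt {f f' ν : ℝ → ℝ} {f'' s₀ : ℝ}
    (hf : ∀ s, HasDerivAt f (f' s) s) (hf' : HasDerivAt f' f'' s₀)
    (hν : ∀ s, ν s = √(f s)) (hνpos : ∀ᶠ s in 𝓝 s₀, 0 < ν s) :
    iteratedDeriv 2 ν s₀ =
      (f'' * (2 * ν s₀) - f' s₀ * (2 * (f' s₀ / (2 * ν s₀)))) / (2 * ν s₀) ^ 2 := by
  have hpos : 0 < ν s₀ := hνpos.self_of_nhds
  have hd : deriv ν =ᶠ[𝓝 s₀] fun s => f' s / (2 * ν s) := by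
    filter_upwards [hνpos] with s hs
    exact (hasDerivAt_of_eq_sqrt hf hν hs).deriv
  rw [iteratedDeriv_succ, iteratedDeriv_one, hd.deriv_eq]
  exact (hf'.fun_div ((hasDerivAt_of_eq_sqrt hf hν hpos).const_mul 2) (by positivity)).deriv

/-- The iterated derivatives of order below `n` of a `C^n` function are differentiable. -/
theorem ContDiff.hasDerivAt_iteratedDeriv_s5 {f : ℝ → ℝ} {n : ℕ} (hf : ContDiff ℝ n f) {m : ℕ}
    (hm : m < n) (s : ℝ) : HasDerivAt (iteratedDeriv m f) (iteratedDeriv (m + 1) f s) s := by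
  rw [iteratedDeriv_succ]
  exact (hf.differentiable_iteratedDeriv m (by exact_mod_cast hm) s).hasDerivAt

theorem statement5 (κ τ : ℝ → ℝ) (hκ : ContDiff ℝ 4 κ) (hτ : ContDiff ℝ 4 τ)
    (s₀ : ℝ) (ν Q T P : ℝ → ℝ)
    (hν : ∀ s, ν s = Real.sqrt (deriv κ s ^ 2 + κ s ^ 2 * τ s ^ 2))
    (hνpos : ∀ᶠ s in 𝓝 s₀, 0 < ν s)
    (hQ : ∀ s, Q s =
      (4 * (iteratedDeriv 2 ν s - κ s ^ 2 * ν s) * ν s - 5 * deriv ν s ^ 2) /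
        (8 * ν s ^ 3))
    (hT : ∀ s, T s =
      (2 * deriv κ s ^ 2 * τ s + κ s ^ 2 * τ s ^ 3 + κ s * deriv κ s * deriv τ s -
          κ s * iteratedDeriv 2 κ s * τ s) / ν s ^ ((5 : ℝ) / 2))
    (hP : ∀ s, P s =
      (2 * κ s * τ s * deriv κ s ^ 2 * (20 * deriv κ s * deriv τ s -
            19 * τ s * iteratedDeriv 2 κ s) +
          2 * κ s ^ 3 * τ s ^ 3 * (5 * deriv κ s * deriv τ s -
            4 * τ s * iteratedDeriv 2 κ s) +
          deriv κ s ^ 2 * (28 * τ s ^ 2 * deriv κ s ^ 2 - 5 * iteratedDeriv 2 κ s ^ 2 +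
            4 * deriv κ s * iteratedDeriv 3 κ s) +
          κ s ^ 2 * (19 * τ s ^ 4 * deriv κ s ^ 2 - 4 * deriv κ s ^ 4 +
            10 * deriv κ s ^ 2 * deriv τ s ^ 2 +
            2 * τ s * deriv κ s * (2 * deriv κ s * iteratedDeriv 2 τ s -
              15 * deriv τ s * iteratedDeriv 2 κ s) +
            2 * τ s ^ 2 * (5 * iteratedDeriv 2 κ s ^ 2 +
              2 * deriv κ s * iteratedDeriv 3 κ s)) +
          κ s ^ 4 * τ s ^ 2 * (6 * τ s ^ 4 - 8 * deriv κ s ^ 2 - 5 * deriv τ s ^ 2 +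
            4 * τ s * iteratedDeriv 2 τ s) -
          4 * κ s ^ 6 * τ s ^ 4) / (192 * ν s ^ 5)) :
    P s₀ = 1 / 24 * (Q s₀ + 3 / 4 * T s₀ ^ 2) := by
  have hκ₀ (s : ℝ) : HasDerivAt κ (deriv κ s) s := by
    simpa using hκ.hasDerivAt_iteratedDeriv_s5 (m := 0) (by norm_num) s
  have hκ₁ (s : ℝ) : HasDerivAt (deriv κ) (iteratedDeriv 2 κ s) s := by
    simpa using hκ.hasDerivAt_iteratedDeriv_s5 (m := 1) (by norm_num) s
  have hκ₂ (s : ℝ) : HasDerivAt (iteratedDeriv 2 κ) (iteratedDeriv 3 κ s) s :=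
    hκ.hasDerivAt_iteratedDeriv_s5 (m := 2) (by norm_num) s
  have hτ₀ (s : ℝ) : HasDerivAt τ (deriv τ s) s := by
    simpa using hτ.hasDerivAt_iteratedDeriv_s5 (m := 0) (by norm_num) s
  have hτ₁ (s : ℝ) : HasDerivAt (deriv τ) (iteratedDeriv 2 τ s) s := by
    simpa using hτ.hasDerivAt_iteratedDeriv_s5 (m := 1) (by norm_num) s
  have hg (s : ℝ) : HasDerivAt (fun s => deriv κ s ^ 2 + κ s ^ 2 * τ s ^ 2)
      (2 * (deriv κ s * iteratedDeriv 2 κ s + κ s * τ s * (deriv κ s * τ s + κ s * deriv τ s)))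
      s := by
    refine (((hκ₁ s).fun_pow 2).fun_add
      (((hκ₀ s).fun_pow 2).fun_mul ((hτ₀ s).fun_pow 2))).congr_deriv ?_
    push_cast
    ring
  have hg' := (((hκ₁ s₀).fun_mul (hκ₂ s₀)).fun_add (((hκ₀ s₀).fun_mul (hτ₀ s₀)).fun_mul
    (((hκ₁ s₀).fun_mul (hτ₀ s₀)).fun_add ((hκ₀ s₀).fun_mul (hτ₁ s₀))))).const_mul 2
  have hpos : 0 < ν s₀ := hνpos.self_of_nhds
  have hsq : ν s₀ ^ 2 = deriv κ s₀ ^ 2 + κ s₀ ^ 2 * τ s₀ ^ 2 := by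
    rw [hν, Real.sq_sqrt (by positivity)]
  have hpow : (ν s₀ ^ ((5 : ℝ) / 2)) ^ 2 = ν s₀ ^ 5 := by
    rw [← Real.rpow_mul_natCast hpos.le, ← Real.rpow_natCast]
    norm_num
  rw [hP, hQ, hT, div_pow, hpow, iteratedDeriv_two_of_eq_sqrt hg hg' hν hνpos,
    (hasDerivAt_of_eq_sqrt hg hν hpos).deriv]
  generalize iteratedDeriv 3 κ s₀ = κ₃, iteratedDeriv 2 κ s₀ = κ₂, deriv κ s₀ = κ₁, κ s₀ = κ₀,
    iteratedDeriv 2 τ s₀ = τ₂, deriv τ s₀ = τ₁, τ s₀ = τ₀, ν s₀ = n at *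
  have hn4 : n ^ 4 = (κ₁ ^ 2 + κ₀ ^ 2 * τ₀ ^ 2) ^ 2 := by rw [← hsq, ← pow_mul]
  field_simp
  ring_nf
  rw [hn4, hsq]
  ring
end
end
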